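/- arXiv:2110.15540 — 2 statements merged into one kernel-verified Lean document; each statement's English description precedes it below -/
import Mathlib

section
/- Let d ≥ 2 and n ∈ ℕ, and let Γ_{n,0} = {γ : γ is a contour, |γ| = n, 0 ∈ int γ}. Then |Γ_{n,0}| ≤ (n+1)·C_d^{2n+1}, where C_d is the number of (d-1)-dimensional faces of the unit cubes I_x (x ∈ Z^d) which are not equal to the face {1/2} × [-1/2,1/2]^{d-1} but intersect it. -/
open scoped BigOperators
open Real MeasureTheory Filter Topology

namespace Ising

/-- The lattice `ℤ^d`. -/
abbrev V (d : ℕ) := Fin d → ℤ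
/-- Spin configurations on `ℤ^d`; `true` encodes spin `+1`, `false` encodes spin `-1`. -/
abbrev Config (d : ℕ) := V d → Bool
/-- The ambient euclidean space `ℝ^d`. -/
abbrev Point (d : ℕ) := Fin d → ℝ

variable {d : ℕ}

noncomputable section

/-- The spin value (`±1`) of a boolean. -/
def spin (b : Bool) : ℝ := if b then 1 else -1

/-- An interaction assigns to each finite `Λ ⊆ ℤ^d` a function of configurations
(only the restriction to `Λ` is relevant; see `IsLocal`). -/
abbrev Interaction (d : ℕ) := Finset (V d) → Config d → ℝ

/-- `Φ_Λ` depends only on the restriction of the configuration to `Λ`. -/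
def IsLocal (Φ : Interaction d) : Prop :=
  ∀ (Λ : Finset (V d)) (ω ω' : Config d), (∀ x ∈ Λ, ω x = ω' x) → Φ Λ ω = Φ Λ ω'

/-- Translation of a configuration: `(τ^a ω)(x) = ω(x+a)`. -/
def translate (a : V d) (ω : Config d) : Config d := fun x => ω (x + a)

/-- Translation invariance of an interaction: `Φ_Λ(ω) = Φ_{Λ-a}(τ^a ω)`. -/
def TransInv (Φ : Interaction d) : Prop :=
  ∀ (a : V d) (Λ : Finset (V d)) (ω : Config d),
    Φ (Λ.image (fun x => x - a)) (translate a ω) = Φ Λ ω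

/-- Spin-flip symmetry: `Ψ_Λ(ω) = Ψ_Λ(-ω)`. -/
def SpinFlipSymm (Ψ : Interaction d) : Prop :=
  ∀ (Λ : Finset (V d)) (ω : Config d), Ψ Λ (fun x => !(ω x)) = Ψ Λ ω

/-- `sup_{ω ∈ Ω_Λ} |Φ_Λ(ω)|`. -/
def supNorm (Φ : Interaction d) (Λ : Finset (V d)) : ℝ := ⨆ ω : Config d, |Φ Λ ω|

/-- The summand of the norm `‖Φ‖`. -/
def normTerm (Φ : Interaction d) (Λ : Finset (V d)) : ℝ :=
  if (0 : V d) ∈ Λ then supNorm Φ Λ else 0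

/-- `‖Φ‖ = Σ_{0 ∈ Λ ⋐ ℤ^d} sup_{ω} |Φ_Λ(ω)|`. -/
def anorm (Φ : Interaction d) : ℝ := ∑' Λ : Finset (V d), normTerm Φ Λ

/-- Absolute summability of an interaction. -/
def AbsSummable (Φ : Interaction d) : Prop := Summable (normTerm Φ)

/-- `‖x-y‖_∞`. -/
def distInf (x y : V d) : ℕ := Finset.univ.sup fun i => (x i - y i).natAbs

/-- `‖x-y‖_1`. -/
def dist1 (x y : V d) : ℕ := ∑ i, (x i - y i).natAbs

/-- `diam(Λ) = sup {‖x-y‖_∞ : x, y ∈ Λ}`. -/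
def diam (Λ : Finset (V d)) : ℕ := Λ.sup fun x => Λ.sup fun y => distInf x y

/-- The summand of the `d`-th order decaying norm `|||Ψ|||`. -/
def dTerm (Ψ : Interaction d) (Λ : Finset (V d)) : ℝ :=
  if (0 : V d) ∈ Λ then ((diam Λ + 1 : ℕ) : ℝ) ^ d * supNorm Ψ Λ else 0

/-- `|||Ψ||| = Σ_{0 ∈ Λ ⋐ ℤ^d} (diam(Λ)+1)^d sup_{ω} |Ψ_Λ(ω)|`. -/
def dnorm (Ψ : Interaction d) : ℝ := ∑' Λ : Finset (V d), dTerm Ψ Λ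

/-- Summability of the `d`-th order decaying norm. -/
def DSummable (Ψ : Interaction d) : Prop := Summable (dTerm Ψ)

/-- The summand of the norm `|||Ψ|||'`. -/
def dTerm' (Ψ : Interaction d) (Λ : Finset (V d)) : ℝ :=
  if (0 : V d) ∈ Λ then (Λ.card : ℝ)⁻¹ * ((diam Λ + 1 : ℕ) : ℝ) ^ d * supNorm Ψ Λ else 0

/-- `|||Ψ|||' = Σ_{0 ∈ Λ ⋐ ℤ^d} |Λ|⁻¹ (diam(Λ)+1)^d sup_{ω} |Ψ_Λ(ω)|`. -/
def dnorm' (Ψ : Interaction d) : ℝ := ∑' Λ : Finset (V d), dTerm' Ψ Λ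

/-- Summability of the norm `|||·|||'`. -/
def DSummable' (Ψ : Interaction d) : Prop := Summable (dTerm' Ψ)

/-- The Hamiltonian `H_{Φ,Λ}(ω) = Σ_{Δ ⋐ ℤ^d, Δ ∩ Λ ≠ ∅} Φ_Δ(ω|_Δ)`. -/
def ham (Φ : Interaction d) (Λ : Finset (V d)) (ω : Config d) : ℝ :=
  ∑' Δ : Finset (V d), if (Δ ∩ Λ).Nonempty then Φ Δ ω else 0

/-- The configuration `ω_Λ ∨ η` agreeing with `f` on `Λ` and with `η` off `Λ`. -/
def fill (Λ : Finset (V d)) (f : ↥Λ → Bool) (η : Config d) : Config d :=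
  fun x => if h : x ∈ Λ then f ⟨x, h⟩ else η x

/-- The partition function `Z^η_{Φ,Λ}`. -/
def gibbsZ (Φ : Interaction d) (Λ : Finset (V d)) (η : Config d) : ℝ :=
  ∑ f : ↥Λ → Bool, Real.exp (-(ham Φ Λ (fill Λ f η)))

/-- The finite Gibbs state `μ^η_{Φ,Λ}({ω_Λ})`. -/
def finGibbs (Φ : Interaction d) (Λ : Finset (V d)) (η : Config d) (f : ↥Λ → Bool) : ℝ :=
  Real.exp (-(ham Φ Λ (fill Λ f η))) / gibbsZ Φ Λ η

/-- The cylinder set `{ξ : ξ|_Λ = f}`. -/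
def cyl (Λ : Finset (V d)) (f : ↥Λ → Bool) : Set (Config d) :=
  {ξ | ∀ (x : V d) (h : x ∈ Λ), ξ x = f ⟨x, h⟩}

/-- `σ` is a Gibbs state for `Φ` (DLR condition): for each finite `Λ` there is a Borel
probability measure on boundary conditions with respect to which `σ` of each cylinder
is the average of the finite Gibbs states. -/
def IsGibbs (Φ : Interaction d) (σ : Measure (Config d)) : Prop :=
  IsProbabilityMeasure σ ∧
  ∀ Λ : Finset (V d), ∃ ν : Measure (Config d), IsProbabilityMeasure ν ∧
    ∀ f : ↥Λ → Bool, (σ (cyl Λ f)).toReal = ∫ η, finGibbs Φ Λ η f ∂ν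

/-- Translation invariance of a measure: `τ^a_* σ = σ`. -/
def MeasTransInv (σ : Measure (Config d)) : Prop :=
  ∀ a : V d, σ.map (translate a) = σ

/-- The Ising interaction at inverse temperature `β`:
`Φ^β_Λ(ω) = -β ω(x) ω(y)` if `Λ = {x,y}` with `‖x-y‖₁ = 1`, and `0` otherwise. -/
def ising (β : ℝ) : Interaction d := fun Λ ω =>
  if Λ.card = 2 ∧ ∀ x ∈ Λ, ∀ y ∈ Λ, x ≠ y → dist1 x y = 1
  then -β * ∏ x ∈ Λ, spin (ω x) else 0

/-- The sum of two interactions. -/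
def Iadd (Φ Ψ : Interaction d) : Interaction d := fun Λ ω => Φ Λ ω + Ψ Λ ω

/-- `S` is connected for the adjacency given by `ρ`-distance `1`. -/
def ConnectedBy (ρ : V d → V d → ℕ) (S : Set (V d)) : Prop :=
  ∀ x ∈ S, ∀ y ∈ S, ∃ (n : ℕ) (p : ℕ → V d), p 0 = x ∧ p n = y ∧
    (∀ i ≤ n, p i ∈ S) ∧ ∀ i < n, ρ (p i) (p (i+1)) = 1

/-- `‖·‖₁`-connectedness. -/
def Conn1 (S : Set (V d)) : Prop := ConnectedBy dist1 S

/-- `‖·‖_∞`-connectedness. -/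
def ConnInf (S : Set (V d)) : Prop := ConnectedBy distInf S

/-- A finite set `Λ` is c-connected if both `Λ` and its complement are `‖·‖_∞`-connected. -/
def CConn (Λ : Finset (V d)) : Prop :=
  ConnInf (↑Λ : Set (V d)) ∧ ConnInf ((↑Λ : Set (V d))ᶜ)

/-- `Ψ` vanishes on sets that are not `‖·‖₁`-connected. -/
def ZeroOnNonConn (Ψ : Interaction d) : Prop :=
  ∀ Λ : Finset (V d), ¬ Conn1 (↑Λ : Set (V d)) → ∀ ω, Ψ Λ ω = 0

/-- The closed unit cube `I_x` centered at `x ∈ ℤ^d`. -/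
def cube (x : V d) : Set (Point d) := {y | ∀ i, |y i - (x i : ℝ)| ≤ 1/2}

/-- `M(S) = ⋃_{x ∈ S} I_x`. -/
def cubes (S : Set (V d)) : Set (Point d) := ⋃ x ∈ S, cube x

/-- A contour is the boundary `∂M(S)` of `M(S)` for a finite c-connected `S`. -/
def IsContour (γ : Set (Point d)) : Prop :=
  ∃ S : Finset (V d), CConn S ∧ γ = frontier (cubes ↑S)

/-- The set of sites with spin `-1`. -/
def minusSet (ω : Config d) : Set (V d) := {x | ω x = false}

/-- `Γ(ω)`: the connected components of `∂M({x : ω(x) = -1})`. -/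
def Gamma (ω : Config d) : Set (Set (Point d)) :=
  {γ | ∃ y ∈ frontier (cubes (minusSet ω)),
    γ = connectedComponentIn (frontier (cubes (minusSet ω))) y}

/-- The `(d-1)`-dimensional face of the unit cubes lying between `x` and `x + e_i`. -/
def face (x : V d) (i : Fin d) : Set (Point d) :=
  {y | y i = (x i : ℝ) + 1/2 ∧ ∀ j, j ≠ i → |y j - (x j : ℝ)| ≤ 1/2}

/-- A plaquette is a `(d-1)`-dimensional face of one of the cubes `I_x`. -/
def IsPlaquette (P : Set (Point d)) : Prop := ∃ x i, P = face x i

/-- `|γ|`: the number of plaquettes contained in `γ`. -/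
def csize (γ : Set (Point d)) : ℕ :=
  Nat.card {P : Set (Point d) // IsPlaquette P ∧ P ⊆ γ}

/-- The constant `+1` configuration. -/
def plusC : Config d := fun _ => true

/-- The constant `-1` configuration. -/
def minusC : Config d := fun _ => false

open scoped Classical in
/-- The finite-volume Gibbs probability (with boundary condition `η`) of an event
`A`: `μ^η_{Φ,Λ}({ω : ω ∨ η ∈ A})`. -/
def bcProb (Φ : Interaction d) (Λ : Finset (V d)) (η : Config d) (A : Set (Config d)) : ℝ :=
  (∑ f : ↥Λ → Bool, if fill Λ f η ∈ A then Real.exp (-(ham Φ Λ (fill Λ f η))) else 0) /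
    gibbsZ Φ Λ η

/-- `ω ∈ Ω_Λ^+`, i.e. `ω` is `+1` off `Λ`. -/
def plusOutside (Λ : Finset (V d)) (ω : Config d) : Prop := ∀ x, x ∉ Λ → ω x = true

/-- The configuration obtained by flipping all spins in `S`. -/
def flipOn (S : Finset (V d)) (ω : Config d) : Config d :=
  fun x => if x ∈ S then !(ω x) else ω x

/-- `|𝓔_Λ|`: the number of nearest-neighbour edges meeting `Λ`. -/
def edgeCount (Λ : Finset (V d)) : ℕ :=
  Nat.card {e : Finset (V d) // (∃ x y, e = {x, y} ∧ dist1 x y = 1) ∧ (e ∩ Λ).Nonempty}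

/-- `R` is a (nonempty) rectangle in `ℤ^d`. -/
def IsRect (R : Finset (V d)) : Prop := ∃ a b : V d, a ≤ b ∧ R = Finset.Icc a b

/-- `R(Λ)`: the minimal rectangle containing `Λ`. -/
def minRect (Λ : Finset (V d)) : Finset (V d) :=
  if h : Λ.Nonempty then
    Finset.Icc (fun i => Λ.inf' h fun x => x i) (fun i => Λ.sup' h fun x => x i)
  else ∅

open scoped Classical in
/-- The rectangle regrouping `Ψ̃` of `Ψ`: `Ψ̃_R(ω) = Σ_{Λ : R(Λ) = R} Ψ_Λ(ω|_Λ)` for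
rectangles `R`, and `Ψ̃_Λ = 0` for non-rectangles. -/
def regroup (Ψ : Interaction d) : Interaction d := fun R ω =>
  if IsRect R then ∑ Λ ∈ R.powerset, (if minRect Λ = R then Ψ Λ ω else 0) else 0


/-- The reference face `{1/2} × [-1/2,1/2]^{d-1}`. -/
def refFace (d : ℕ) (hd : 0 < d) : Set (Point d) := face (0 : V d) ⟨0, hd⟩

/-- `C_d`: the number of `(d-1)`-dimensional faces of the cubes `I_x`, `x ∈ ℤ^d`, which
are not equal to the reference face `{1/2} × [-1/2,1/2]^{d-1}` but intersect it. -/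
def Cd (d : ℕ) (hd : 0 < d) : ℕ :=
  Nat.card {P : Set (Point d) // IsPlaquette P ∧ P ≠ refFace d hd ∧
    (P ∩ refFace d hd).Nonempty}

/-- `Γ_{n,0}`: the set of contours `γ` with `|γ| = n` and `0 ∈ int γ`. -/
def GammaN0 (d : ℕ) (n : ℕ) : Set (Set (Point d)) :=
  {γ | ∃ S : Finset (V d), CConn S ∧ γ = frontier (cubes (↑S : Set (V d))) ∧
    csize γ = n ∧ (0 : V d) ∈ S}

/-! ### Helper material for the proof -/

/-- The face attached to an (oriented) edge. -/
def eface (e : V d × Fin d) : Set (Point d) := face e.1 e.2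

/-- The edge boundary of `S`. -/
def bd (S : Finset (V d)) : Set (V d × Fin d) :=
  {e | ¬ (e.1 ∈ S ↔ e.1 + Pi.single e.2 1 ∈ S)}

/-- Two distinct faces that intersect. -/
def nbr (e e' : V d × Fin d) : Prop := e' ≠ e ∧ (eface e' ∩ eface e).Nonempty

lemma nbr_symm {e e' : V d × Fin d} (h : nbr e e') : nbr e' e :=
  ⟨h.1.symm, by rw [Set.inter_comm]; exact h.2⟩

lemma int_eq_of_abs_lt {a b : ℤ} (h : |(a : ℝ) - b| < 1) : a = b := by
  rw [abs_lt] at h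
  have h1 : (a : ℝ) < b + 1 := by linarith
  have h2 : (b : ℝ) < a + 1 := by linarith
  have h1' : a < b + 1 := by exact_mod_cast h1
  have h2' : b < a + 1 := by exact_mod_cast h2
  omega

lemma isClosed_cube (x : V d) : IsClosed (cube x) := by
  have : cube x = ⋂ i, {y : Point d | |y i - (x i : ℝ)| ≤ 1/2} := by
    ext y; simp [cube]
  rw [this]
  exact isClosed_iInter fun i => isClosed_le (by fun_prop) continuous_const

lemma isClosed_cubes (S : Finset (V d)) : IsClosed (cubes (↑S : Set (V d))) := by
  unfold cubes
  exact S.finite_toSet.isClosed_biUnion fun x _ => isClosed_cube x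

lemma face_subset_cube (x : V d) (i : Fin d) : face x i ⊆ cube x := by
  intro y hy j
  by_cases h : j = i
  · subst h
    rw [hy.1]; norm_num
  · exact hy.2 j h

lemma face_subset_cube' (x : V d) (i : Fin d) : face x i ⊆ cube (x + Pi.single i 1) := by
  intro y hy j
  by_cases h : j = i
  · subst h
    simp only [Pi.add_apply, Pi.single_eq_same, Int.cast_add, Int.cast_one]
    rw [hy.1, abs_le]; constructor <;> linarith
  · simp only [Pi.add_apply, Pi.single_eq_of_ne h, add_zero]
    exact hy.2 j h

lemma mem_frontier_of {S : Finset (V d)} {x y : V d} (hx : x ∈ S) (hy : y ∉ S) {p : Point d}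
    (hpx : p ∈ cube x) (hpy : p ∈ cube y) : p ∈ frontier (cubes (↑S : Set (V d))) := by
  rw [(isClosed_cubes S).frontier_eq]
  refine ⟨Set.mem_biUnion (by exact_mod_cast hx) hpx, fun hint => ?_⟩
  let q : ℝ → Point d := fun t i => p i + t * ((y i : ℝ) - p i)
  have hq : Continuous q := by fun_prop
  have hq0 : q 0 = p := by ext i; simp [q]
  have h1 : ∀ᶠ t in 𝓝 (0 : ℝ), q t ∈ interior (cubes (↑S : Set (V d))) := by
    apply hq.continuousAt.eventually_mem
    rw [hq0]; exact isOpen_interior.mem_nhds hint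
  have h2 : ∀ᶠ t in 𝓝[>] (0 : ℝ), q t ∈ interior (cubes (↑S : Set (V d))) :=
    h1.filter_mono nhdsWithin_le_nhds
  have h3 : ∀ᶠ t in 𝓝[>] (0 : ℝ), t ∈ Set.Ioo (0 : ℝ) 1 := Ioo_mem_nhdsGT one_pos
  obtain ⟨t, ht, ht0, ht1⟩ := (h2.and h3).exists
  have ht' := interior_subset ht
  simp only [cubes, Set.mem_iUnion] at ht'
  obtain ⟨z, hz, hz2⟩ := ht'
  have : z = y := by
    ext i
    apply int_eq_of_abs_lt
    have ha := hz2 i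
    have hb := hpy i
    have hb' : |q t i - (y i : ℝ)| < 1/2 := by
      have : q t i - (y i : ℝ) = (1 - t) * (p i - y i) := by simp only [q]; ring
      rw [this, abs_mul, abs_of_pos (by linarith)]
      nlinarith [abs_nonneg (p i - y i)]
    rw [abs_le] at ha
    rw [abs_lt] at hb' ⊢
    constructor <;> linarith
  subst this
  exact hy (by exact_mod_cast hz)

/-- The centre of a face. -/
def ctr (e : V d × Fin d) : Point d := fun j => (e.1 j : ℝ) + if j = e.2 then 1/2 else 0

lemma ctr_mem (e : V d × Fin d) : ctr e ∈ eface e := by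
  refine ⟨by simp [ctr], fun j hj => ?_⟩
  simp [ctr, hj]

lemma eface_subset_frontier (S : Finset (V d)) (e : V d × Fin d) :
    eface e ⊆ frontier (cubes (↑S : Set (V d))) ↔ e ∈ bd S := by
  obtain ⟨x, i⟩ := e
  constructor
  · intro h hiff
    have hc := h (ctr_mem (x, i))
    rw [(isClosed_cubes S).frontier_eq] at hc
    obtain ⟨hc1, hc2⟩ := hc
    by_cases hx : x ∈ S
    · have hx' := hiff.1 hx
      apply hc2
      rw [mem_interior_iff_mem_nhds]
      refine mem_of_superset (Metric.ball_mem_nhds _ (by norm_num : (0 : ℝ) < 1/2)) ?_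
      intro p hp
      rw [Metric.mem_ball, dist_pi_lt_iff (by norm_num)] at hp
      simp only [ctr, Real.dist_eq] at hp
      simp only [cubes, Set.mem_iUnion]
      by_cases hpi : p i ≤ x i + 1/2
      · refine ⟨x, by exact_mod_cast hx, fun j => ?_⟩
        have := hp j
        by_cases hj : j = i
        · subst hj
          simp only [if_true] at this
          rw [abs_lt] at this; rw [abs_le]; constructor <;> linarith
        · simp only [if_neg hj, add_zero] at this
          exact this.le
      · refine ⟨x + Pi.single i 1, by exact_mod_cast hx', fun j => ?_⟩
        have := hp j
        by_cases hj : j = i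
        · subst hj
          simp only [if_true] at this
          simp only [Pi.add_apply, Pi.single_eq_same, Int.cast_add, Int.cast_one]
          rw [abs_lt] at this; rw [abs_le]; constructor <;> linarith
        · simp only [if_neg hj, add_zero] at this
          simp only [Pi.add_apply, Pi.single_eq_of_ne hj, add_zero]
          exact this.le
    · have hx' : x + Pi.single i 1 ∉ S := fun h => hx (hiff.2 h)
      simp only [cubes, Set.mem_iUnion] at hc1
      obtain ⟨z, hz, hz2⟩ := hc1
      have hz : z ∈ S := by exact_mod_cast hz
      have hne : ∀ j, j ≠ i → z j = x j := by
        intro j hj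
        have := hz2 j
        simp only [ctr, if_neg hj, add_zero] at this
        symm
        apply int_eq_of_abs_lt
        linarith
      have hi := hz2 i
      simp only [ctr, if_true] at hi
      rw [abs_le] at hi
      have h1 : (x i : ℝ) ≤ z i := by linarith
      have h2 : (z i : ℝ) ≤ x i + 1 := by linarith
      have h1' : x i ≤ z i := by exact_mod_cast h1
      have h2' : z i ≤ x i + 1 := by exact_mod_cast h2
      by_cases h3 : z i = x i
      · apply hx
        have : z = x := by
          ext j
          by_cases hj : j = i
          · rw [hj, h3]
          · exact hne j hj
        rwa [this] at hz
      · apply hx'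
        have : z = x + Pi.single i 1 := by
          ext j
          by_cases hj : j = i
          · subst hj
            simp only [Pi.add_apply, Pi.single_eq_same]; omega
          · simp only [Pi.add_apply, Pi.single_eq_of_ne hj, add_zero]
            exact hne j hj
        rwa [this] at hz
  · intro h p hp
    have h1 := face_subset_cube x i hp
    have h2 := face_subset_cube' x i hp
    simp only [bd, Set.mem_setOf_eq] at h
    by_cases hx : x ∈ S
    · exact mem_frontier_of hx (by tauto) h1 h2
    · exact mem_frontier_of (by tauto) hx h2 h1

lemma eface_injective : Function.Injective (eface (d := d)) := by
  rintro ⟨x, i⟩ ⟨x', i'⟩ h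
  have hc : ctr (x, i) ∈ eface (x', i') := h ▸ ctr_mem (x, i)
  obtain ⟨h1, h2⟩ := hc
  simp only [ctr] at h1 h2
  have hi : i' = i := by
    by_contra hne
    rw [if_neg hne, add_zero] at h1
    have h3 : (2 * x i' : ℝ) = 2 * x' i' + 1 := by linarith
    have h4 : (2 * x i' : ℤ) = 2 * x' i' + 1 := by exact_mod_cast h3
    omega
  subst hi
  have : x = x' := by
    ext j
    by_cases hj : j = i'
    · subst hj
      simp only [if_true] at h1
      have : (x j : ℝ) = x' j := by linarith
      exact_mod_cast this
    · have := h2 j hj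
      rw [if_neg hj, add_zero] at this
      apply int_eq_of_abs_lt
      linarith
  rw [this]

lemma bd_finite (S : Finset (V d)) : (bd S).Finite := by
  have h1 : ((↑S : Set (V d)) ×ˢ (Set.univ : Set (Fin d))).Finite :=
    S.finite_toSet.prod Set.finite_univ
  have h2 : ((fun e : V d × Fin d => (e.1 - Pi.single e.2 1, e.2)) ''
      ((↑S : Set (V d)) ×ˢ (Set.univ : Set (Fin d)))).Finite := h1.image _
  refine (h1.union h2).subset ?_
  rintro ⟨x, i⟩ he
  simp only [bd, Set.mem_setOf_eq] at he
  by_cases hx : x ∈ S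
  · left; simp [hx]
  · right
    refine ⟨(x + Pi.single i 1, i), ?_, by simp⟩
    simp only [Set.mem_prod, Finset.mem_coe, Set.mem_univ, and_true]
    tauto

lemma csize_eq (S : Finset (V d)) :
    csize (frontier (cubes (↑S : Set (V d)))) = (bd S).ncard := by
  unfold csize
  rw [← Nat.card_coe_set_eq]
  symm
  refine Nat.card_congr (Equiv.ofBijective
    (fun e => ⟨eface e.1, ⟨e.1.1, e.1.2, rfl⟩, (eface_subset_frontier S e.1).2 e.2⟩) ⟨?_, ?_⟩)
  · intro e e' h
    apply Subtype.ext
    apply eface_injective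
    exact congrArg Subtype.val h
  · rintro ⟨P, ⟨x, i, rfl⟩, hP⟩
    exact ⟨⟨(x, i), (eface_subset_frontier S (x, i)).1 hP⟩, rfl⟩

lemma exists_exit (S : Finset (V d)) (x : V d) (hx : x ∈ S) (i : Fin d) :
    ∃ k : ℕ, (∀ j ≤ k, x + Pi.single i (j : ℤ) ∈ S) ∧ x + Pi.single i ((k : ℤ) + 1) ∉ S := by
  have hex : ∃ k : ℕ, x + Pi.single i ((k : ℤ) + 1) ∉ S := by
    by_contra! hcon
    have : Function.Injective (fun k : ℕ => (⟨x + Pi.single i ((k : ℤ) + 1), hcon k⟩ : S)) := by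
      intro a b hab
      have h1 := congrFun (congrArg Subtype.val hab) i
      simp at h1
      exact h1
    exact not_injective_infinite_finite _ this
  classical
  refine ⟨Nat.find hex, fun j hj => ?_, Nat.find_spec hex⟩
  rcases j with _ | j
  · simpa using hx
  · have := Nat.find_min hex (m := j) (by omega)
    push Not at this
    simpa using this

lemma bd_injective (i0 : Fin d) : Function.Injective (bd (d := d)) := by
  have key : ∀ S S' : Finset (V d), bd S = bd S' → ∀ x, x ∈ S → x ∈ S' := by
    intro S S' h x hx
    obtain ⟨k, hk1, hk2⟩ := exists_exit (S ∪ S') x (Finset.mem_union_left _ hx) i0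
    have hiff : ∀ y, ((y ∈ S ↔ y ∈ S') ↔
        (y + Pi.single i0 1 ∈ S ↔ y + Pi.single i0 1 ∈ S')) := by
      intro y
      have : (y, i0) ∈ bd S ↔ (y, i0) ∈ bd S' := by rw [h]
      simp only [bd, Set.mem_setOf_eq] at this
      tauto
    have : ∀ j : ℕ, ((x ∈ S ↔ x ∈ S') ↔
        (x + Pi.single i0 (j : ℤ) ∈ S ↔ x + Pi.single i0 (j : ℤ) ∈ S')) := by
      intro j
      induction j with
      | zero => simp
      | succ j ih =>
        rw [ih, hiff, add_assoc, ← Pi.single_add]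
        push_cast
        rfl
    have h2 := this (k + 1)
    push_cast at h2
    simp only [Finset.mem_union, not_or] at hk2
    tauto
  intro S S' h
  ext x
  exact ⟨key S S' h x, key S' S h.symm x⟩

lemma zmod2_add_eq (a b c : ZMod 2) (h : a + b = c) : a = b + c := by
  revert a b c; decide

/-- Boundary edges lying in one unit hypercube. -/
lemma hypercube (S : Finset (V d)) (A : Set (V d × Fin d)) (hAS : A ⊆ bd S)
    (hA : ∀ e ∈ A, ∀ e' ∈ bd S, (eface e ∩ eface e').Nonempty → e' ∈ A)
    (a : V d × Fin d → ZMod 2) (ha1 : ∀ e ∈ A, a e = 1) (ha0 : ∀ e ∉ A, a e = 0)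
    (s : V d → ZMod 2) (hs1 : ∀ x ∈ S, s x = 1) (hs0 : ∀ x ∉ S, s x = 0) (m : V d) :
    ∃ c : ZMod 2, ∀ (T : Finset (Fin d)) (i : Fin d), i ∉ T →
      a (m + (fun j => if j ∈ T then 1 else 0), i) =
        c * (s (m + (fun j => if j ∈ T then 1 else 0)) +
          s (m + (fun j => if j ∈ T then 1 else 0) + Pi.single i 1)) := by
  have hin : ∀ (T : Finset (Fin d)) (i : Fin d), i ∉ T →
      (fun j => (m j : ℝ) + 1/2 : Point d) ∈
        eface (m + (fun j => if j ∈ T then 1 else 0), i) := by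
    intro T i hi
    refine ⟨by simp [hi], fun j hj => ?_⟩
    by_cases hjT : j ∈ T
    · simp only [Pi.add_apply, hjT, if_true]
      push_cast
      rw [abs_le]; constructor <;> linarith
    · simp only [Pi.add_apply, hjT, if_false]
      push_cast
      rw [abs_le]; constructor <;> linarith
  have hδ : ∀ e ∈ bd S, s e.1 + s (e.1 + Pi.single e.2 1) = 1 := by
    intro e he
    simp only [bd, Set.mem_setOf_eq] at he
    by_cases hx : e.1 ∈ S
    · rw [hs1 _ hx, hs0 _ (by tauto)]; rfl
    · rw [hs0 _ hx, hs1 _ (by tauto)]; rfl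
  have hδ0 : ∀ e ∉ bd S, s e.1 + s (e.1 + Pi.single e.2 1) = 0 := by
    intro e he
    simp only [bd, Set.mem_setOf_eq, not_not] at he
    by_cases hx : e.1 ∈ S
    · rw [hs1 _ hx, hs1 _ (by tauto)]; rfl
    · rw [hs0 _ hx, hs0 _ (by tauto)]; rfl
  by_cases hex : ∃ (T : Finset (Fin d)) (i : Fin d), i ∉ T ∧
      (m + (fun j => if j ∈ T then 1 else 0), i) ∈ A
  · obtain ⟨T0, i0, hi0, h0⟩ := hex
    refine ⟨1, fun T i hi => ?_⟩
    rw [one_mul]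
    by_cases hb : (m + (fun j => if j ∈ T then 1 else 0), i) ∈ bd S
    · rw [ha1 _ (hA _ h0 _ hb ⟨_, hin T0 i0 hi0, hin T i hi⟩)]
      exact (hδ _ hb).symm
    · rw [ha0 _ (fun h => hb (hAS h))]
      exact (hδ0 _ hb).symm
  · push Not at hex
    refine ⟨0, fun T i hi => ?_⟩
    rw [zero_mul, ha0 _ (hex T i hi)]

lemma bd_connected (i0 : Fin d) (S : Finset (V d)) (hS : CConn S) (A : Set (V d × Fin d))
    (hAS : A ⊆ bd S)
    (hA : ∀ e ∈ A, ∀ e' ∈ bd S, (eface e ∩ eface e').Nonempty → e' ∈ A)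
    (hne : A.Nonempty) : bd S ⊆ A := by
  classical
  let a : V d × Fin d → ZMod 2 := fun e => if e ∈ A then 1 else 0
  let s : V d → ZMod 2 := fun x => if x ∈ S then 1 else 0
  have ha1 : ∀ e ∈ A, a e = 1 := fun e he => if_pos he
  have ha0 : ∀ e ∉ A, a e = 0 := fun e he => if_neg he
  have hs1 : ∀ x ∈ S, s x = 1 := fun x he => if_pos he
  have hs0 : ∀ x ∉ S, s x = 0 := fun x he => if_neg he
  have hc := hypercube S A hAS hA a ha1 ha0 s hs1 hs0
  obtain ⟨N, hN⟩ : ∃ N : ℤ, ∀ e ∈ A, e.1 i0 < N := by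
    have hf : ((fun e : V d × Fin d => e.1 i0) '' A).Finite := ((bd_finite S).subset hAS).image _
    obtain ⟨M, hM⟩ := hf.bddAbove
    exact ⟨M + 1, fun e he => Int.lt_add_one_of_le (hM ⟨e, he, rfl⟩)⟩
  have haN : ∀ (x : V d) (i : Fin d), N ≤ x i0 → a (x, i) = 0 := by
    intro x i hx
    apply ha0
    intro h
    have := hN _ h
    simp only at this
    omega
  let f : V d → ZMod 2 := fun x => ∑ t ∈ Finset.Ico (x i0) N, a (Function.update x i0 t, i0)
  have hfN : ∀ x : V d, N ≤ x i0 → f x = 0 := by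
    intro x hx
    simp only [f, Finset.Ico_eq_empty_of_le hx, Finset.sum_empty]
  have hf0 : ∀ x : V d, f x = a (x, i0) + f (x + Pi.single i0 1) := by
    intro x
    by_cases hx : N ≤ x i0
    · rw [hfN x hx, haN x i0 hx, hfN]
      · rfl
      · simp only [Pi.add_apply, Pi.single_eq_same]; omega
    · have hu : ∀ t, Function.update (x + Pi.single i0 1) i0 t = Function.update x i0 t := by
        intro t
        ext j
        by_cases hj : j = i0
        · subst hj; simp
        · simp [Function.update_of_ne hj, Pi.single_eq_of_ne hj]
      simp only [f, hu]
      simp only [Pi.add_apply, Pi.single_eq_same]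
      rw [← Finset.insert_Ico_add_one_left_eq_Ico (by omega : x i0 < N),
        Finset.sum_insert (by simp), Function.update_eq_self]
  -- closedness on unit squares
  have hclosed : ∀ (x : V d) (j : Fin d), j ≠ i0 →
      a (x, i0) + a (x + Pi.single j 1, i0) = a (x, j) + a (x + Pi.single i0 1, j) := by
    intro x j hj
    obtain ⟨c, hcx⟩ := hc x
    have hem : (x + fun k => if k ∈ (∅ : Finset (Fin d)) then (1 : ℤ) else 0) = x := by
      ext k; simp
    have hsi : ∀ i, (x + fun k => if k ∈ ({i} : Finset (Fin d)) then (1 : ℤ) else 0)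
        = x + Pi.single i 1 := by
      intro i; ext k; simp [Pi.single_apply]
    have h1 := hcx ∅ i0 (by simp)
    have h2 := hcx ∅ j (by simp)
    have h3 := hcx {j} i0 (by simpa using hj.symm)
    have h4 := hcx {i0} j (by simpa using hj)
    rw [hem] at h1 h2
    rw [hsi] at h3 h4
    rw [h1, h2, h3, h4, add_right_comm x (Pi.single j 1) (Pi.single i0 1)]
    generalize s x = s1
    generalize s (x + Pi.single i0 1) = s2
    generalize s (x + Pi.single j 1) = s3
    generalize s (x + Pi.single i0 1 + Pi.single j 1) = s4
    clear * - 
    revert c s1 s2 s3 s4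
    decide
  have hfd : ∀ (x : V d) (j : Fin d), f x + f (x + Pi.single j 1) = a (x, j) := by
    intro x j
    by_cases hj : j = i0
    · subst hj
      rw [hf0 x, add_assoc, CharTwo.add_self_eq_zero, add_zero]
    · have main : ∀ (k : ℕ) (x : V d), N ≤ x i0 + k →
          f x + f (x + Pi.single j 1) = a (x, j) := by
        intro k
        induction k with
        | zero =>
          intro x hx
          simp only [Nat.cast_zero, add_zero] at hx
          rw [hfN x hx, haN x j hx, hfN]
          · rfl
          · simp only [Pi.add_apply, Pi.single_eq_of_ne (Ne.symm hj), add_zero]; exact hx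
        | succ k ih =>
          intro x hx
          have h1 := ih (x + Pi.single i0 1) (by
            simp only [Pi.add_apply, Pi.single_eq_same]; push_cast at hx; omega)
          have h2 := hclosed x j hj
          have h3 := hf0 x
          have h4 := hf0 (x + Pi.single j 1)
          rw [add_right_comm x (Pi.single j 1) (Pi.single i0 1)] at h4
          rw [h3, h4]
          revert h1 h2
          generalize a (x, i0) = b1
          generalize a (x, j) = b2
          generalize a (x + Pi.single j 1, i0) = b3
          generalize a (x + Pi.single i0 1, j) = b4
          generalize f (x + Pi.single i0 1) = b5
          generalize f (x + Pi.single i0 1 + Pi.single j 1) = b6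
          clear * -
          revert b1 b2 b3 b4 b5 b6
          decide
      exact main (N - x i0).toNat x (by omega)
  -- `f` is constant along steps inside a level set of `s`
  have hstep : ∀ x y : V d, distInf x y = 1 → s x = s y → f x = f y := by
    intro x y hxy hsxy
    obtain ⟨c, hcm⟩ := hc (fun j => min (x j) (y j))
    set m : V d := fun j => min (x j) (y j) with hm
    have hT : ∀ T : Finset (Fin d), f (m + fun j => if j ∈ T then 1 else 0) +
        c * s (m + fun j => if j ∈ T then 1 else 0) = f m + c * s m := by
      intro T
      induction T using Finset.induction_on with
      | empty =>
        have : (m + fun k => if k ∈ (∅ : Finset (Fin d)) then (1 : ℤ) else 0) = m := by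
          ext k; simp
        rw [this]
      | insert i T hi ih =>
        have hins : (m + fun k => if k ∈ insert i T then (1 : ℤ) else 0) =
            (m + fun k => if k ∈ T then (1 : ℤ) else 0) + Pi.single i 1 := by
          ext k
          by_cases hk : k = i
          · subst hk; simp [hi]
          · simp [hk]
        rw [hins, ← ih]
        have h1 := hfd (m + fun k => if k ∈ T then (1 : ℤ) else 0) i
        rw [hcm T i hi] at h1
        revert h1
        generalize f (m + fun k => if k ∈ T then (1 : ℤ) else 0) = b1
        generalize s (m + fun k => if k ∈ T then (1 : ℤ) else 0) = b2
        generalize f ((m + fun k => if k ∈ T then (1 : ℤ) else 0) + Pi.single i 1) = b3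
        generalize s ((m + fun k => if k ∈ T then (1 : ℤ) else 0) + Pi.single i 1) = b4
        clear * -
        revert b1 b2 b3 b4 c
        decide
    have hco : ∀ j, (x j - y j).natAbs ≤ 1 := by
      intro j
      rw [← hxy]
      exact Finset.le_sup (f := fun i => (x i - y i).natAbs) (Finset.mem_univ j)
    have hx : x = m + fun j => if j ∈ Finset.univ.filter (fun j => x j ≠ m j)
        then (1 : ℤ) else 0 := by
      ext j
      have := hco j
      simp only [Finset.mem_filter, Finset.mem_univ, true_and, Pi.add_apply, hm]
      split_ifs with h <;> omega
    have hy : y = m + fun j => if j ∈ Finset.univ.filter (fun j => y j ≠ m j)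
        then (1 : ℤ) else 0 := by
      ext j
      have := hco j
      simp only [Finset.mem_filter, Finset.mem_univ, true_and, Pi.add_apply, hm]
      split_ifs with h <;> omega
    have h1 := hT (Finset.univ.filter (fun j => x j ≠ m j))
    have h2 := hT (Finset.univ.filter (fun j => y j ≠ m j))
    rw [← hx] at h1
    rw [← hy, ← h1, hsxy] at h2
    exact (add_right_cancel h2).symm
  have hconst : ∀ U : Set (V d), ConnInf U → (∀ x ∈ U, ∀ y ∈ U, s x = s y) →
      ∀ x ∈ U, ∀ y ∈ U, f x = f y := by
    intro U hU hsU x hx y hy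
    obtain ⟨n, p, hp0, hpn, hpU, hp⟩ := hU x hx y hy
    have : ∀ k ≤ n, f (p 0) = f (p k) := by
      intro k
      induction k with
      | zero => intro _; rfl
      | succ k ih =>
        intro hk
        rw [ih (by omega)]
        exact hstep _ _ (hp k (by omega)) (hsU _ (hpU k (by omega)) _ (hpU _ hk))
    rw [← hp0, ← hpn]
    exact this n le_rfl
  have hin : ∀ x ∈ S, ∀ y ∈ S, f x = f y := by
    intro x hx y hy
    refine hconst _ hS.1 ?_ x (by exact_mod_cast hx) y (by exact_mod_cast hy)
    intro x hx y hy
    rw [hs1 x (by exact_mod_cast hx), hs1 y (by exact_mod_cast hy)]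
  have hout : ∀ x ∉ S, ∀ y ∉ S, f x = f y := by
    intro x hx y hy
    refine hconst _ hS.2 ?_ x (by simpa using hx) y (by simpa using hy)
    intro x hx y hy
    rw [hs0 x (by simpa using hx), hs0 y (by simpa using hy)]
  have hends : ∀ e ∈ bd S, ∃ u ∈ S, ∃ w ∉ S, f u + f w = a e := by
    rintro ⟨x, i⟩ he
    have h := hfd x i
    simp only [bd, Set.mem_setOf_eq] at he
    by_cases hx : x ∈ S
    · exact ⟨x, hx, _, by tauto, h⟩
    · exact ⟨x + Pi.single i 1, by tauto, x, hx, by rw [add_comm]; exact h⟩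
  obtain ⟨e0, he0⟩ := hne
  obtain ⟨u, hu, w, hw, huw⟩ := hends e0 (hAS he0)
  intro e he
  obtain ⟨u', hu', w', hw', huw'⟩ := hends e he
  by_contra hcon
  rw [ha0 e hcon, hin u' hu' u hu, hout w' hw' w hw, huw, ha1 e0 he0] at huw'
  exact one_ne_zero huw'

lemma nbr_finite (e : V d × Fin d) : {e' | nbr e e'}.Finite := by
  have h1 : ((Set.Icc (e.1 - 1) (e.1 + 1)) ×ˢ (Set.univ : Set (Fin d))).Finite :=
    (Set.finite_Icc _ _).prod Set.finite_univ
  refine h1.subset ?_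
  rintro e' ⟨-, p, hp1, hp2⟩
  have h1 := face_subset_cube _ _ hp1
  have h2 := face_subset_cube _ _ hp2
  have key : ∀ j, e.1 j - 1 ≤ e'.1 j ∧ e'.1 j ≤ e.1 j + 1 := by
    intro j
    have h1 := abs_le.1 (h1 j)
    have h2 := abs_le.1 (h2 j)
    have h3 : (e.1 j : ℝ) - 1 ≤ e'.1 j := by linarith
    have h4 : (e'.1 j : ℝ) ≤ e.1 j + 1 := by linarith
    exact ⟨by exact_mod_cast h3, by exact_mod_cast h4⟩
  simp only [Set.mem_prod, Set.mem_Icc, Set.mem_univ, and_true]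
  exact ⟨fun j => (key j).1, fun j => (key j).2⟩

lemma Cd_eq (hd : 0 < d) : Cd d hd = Nat.card {e' // nbr ((0 : V d), (⟨0, hd⟩ : Fin d)) e'} := by
  unfold Cd
  symm
  refine Nat.card_congr (Equiv.ofBijective
    (fun e => ⟨eface e.1, ⟨e.1.1, e.1.2, rfl⟩, ?_, ?_⟩) ⟨?_, ?_⟩)
  · intro h
    exact e.2.1 (eface_injective h)
  · exact e.2.2
  · intro e e' h
    apply Subtype.ext
    apply eface_injective
    exact congrArg Subtype.val h
  · rintro ⟨P, ⟨x, i, rfl⟩, hP, hP2⟩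
    refine ⟨⟨(x, i), ?_, hP2⟩, rfl⟩
    intro h
    apply hP
    exact congrArg eface h

lemma nbr_card_le (hd : 0 < d) (e : V d × Fin d) : Nat.card {e' // nbr e e'} ≤ Cd d hd := by
  rw [Cd_eq]
  haveI : Finite {e' // nbr ((0 : V d), (⟨0, hd⟩ : Fin d)) e'} := (nbr_finite _).to_subtype
  obtain ⟨x, i⟩ := e
  let z : Fin d := ⟨0, hd⟩
  let σ : Equiv.Perm (Fin d) := Equiv.swap z i
  have hσσ : ∀ j, σ (σ j) = j := fun j => Equiv.swap_apply_self z i j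
  have hσz : σ i = z := Equiv.swap_apply_right z i
  let φ : V d × Fin d → V d × Fin d := fun e => (fun j => e.1 (σ j) - x (σ j), σ e.2)
  have hφ : Function.Injective φ := by
    rintro ⟨y, k⟩ ⟨y', k'⟩ h
    simp only [φ, Prod.mk.injEq] at h
    obtain ⟨h1, h2⟩ := h
    have h3 : k = k' := σ.injective h2
    have h4 : y = y' := by
      ext j
      have := congrFun h1 (σ j)
      simp only [hσσ] at this
      omega
    rw [h3, h4]
  have hφx : φ (x, i) = (0, z) := by
    simp only [φ, hσz, sub_self]
    rfl
  have hφm : ∀ (e : V d × Fin d) (p : Point d), p ∈ eface e →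
      (fun j => p (σ j) - x (σ j) : Point d) ∈ eface (φ e) := by
    rintro ⟨y, k⟩ p ⟨h1, h2⟩
    refine ⟨?_, fun j hj => ?_⟩
    · simp only [φ, hσσ]
      simp only at h1
      rw [h1]; push_cast; ring
    · have hj' : σ j ≠ k := by
        intro h
        apply hj
        simp only [φ]
        rw [← h, hσσ]
      have := h2 (σ j) hj'
      simp only [φ]
      push_cast
      rw [sub_sub_sub_cancel_right]
      exact this
  refine Nat.card_le_card_of_injective
    (fun e' => ⟨φ e'.1, ?_, ?_⟩) ?_
  · rw [← hφx]
    exact fun h => e'.2.1 (hφ h)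
  · obtain ⟨p, hp1, hp2⟩ := e'.2.2
    refine ⟨_, hφm _ p hp1, ?_⟩
    have := hφm _ p hp2
    rwa [hφx] at this
  · intro e e' h
    exact Subtype.ext (hφ (congrArg Subtype.val h))

lemma Cd_pos (hd : 2 ≤ d) (hd0 : 0 < d) : 0 < Cd d hd0 := by
  rw [Cd_eq]
  haveI : Finite {e' // nbr ((0 : V d), (⟨0, hd0⟩ : Fin d)) e'} := (nbr_finite _).to_subtype
  haveI : Nonempty {e' // nbr ((0 : V d), (⟨0, hd0⟩ : Fin d)) e'} := by
    refine ⟨⟨((0 : V d), (⟨1, by omega⟩ : Fin d)), ?_, (fun _ => 1/2 : Point d), ?_, ?_⟩⟩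
    · simp
    · refine ⟨by simp, fun j _ => ?_⟩
      simp only [Pi.zero_apply, Int.cast_zero, sub_zero]
      rw [abs_of_pos] <;> norm_num
    · refine ⟨by simp, fun j _ => ?_⟩
      simp only [Pi.zero_apply, Int.cast_zero, sub_zero]
      rw [abs_of_pos] <;> norm_num
  exact Nat.card_pos

lemma exists_nb (hd : 2 ≤ d) (hd0 : 0 < d) : ∃ nb : V d × Fin d → Fin (Cd d hd0) → V d × Fin d,
    ∀ e e', nbr e e' → ∃ c, nb e c = e' := by
  have : ∀ e : V d × Fin d, ∃ g : Fin (Cd d hd0) → V d × Fin d,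
      ∀ e', nbr e e' → ∃ c, g c = e' := by
    intro e
    haveI : Finite {e' // nbr e e'} := (nbr_finite e).to_subtype
    have eq := Finite.equivFin {e' // nbr e e'}
    have hle := nbr_card_le hd0 e
    refine ⟨fun c => if h : c.1 < Nat.card {e' // nbr e e'} then (eq.symm ⟨c.1, h⟩).1 else e, ?_⟩
    intro e' he'
    refine ⟨⟨(eq ⟨e', he'⟩).1, lt_of_lt_of_le (eq ⟨e', he'⟩).2 hle⟩, ?_⟩
    simp
  choose nb hnb using this
  exact ⟨nb, hnb⟩

/-- Decoding of a walk from its start and a word of labels. -/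
def decode {α κ : Type*} (nb : α → κ → α) : α → List κ → List α
  | v, [] => [v]
  | v, c :: cs => v :: decode nb (nb v c) cs

lemma exists_decode {α κ : Type*} (nb : α → κ → α) (R : α → α → Prop)
    (h : ∀ e e', R e e' → ∃ c, nb e c = e') (l : List α) :
    ∀ v, List.IsChain R (v :: l) → ∃ cs : List κ, cs.length = l.length ∧ decode nb v cs = v :: l := by
  induction l with
  | nil => intro v _; exact ⟨[], rfl, rfl⟩
  | cons w l ih =>
    intro v hv
    rw [List.isChain_cons_cons] at hv
    obtain ⟨c, hc⟩ := h v w hv.1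
    obtain ⟨cs, h1, h2⟩ := ih w hv.2
    refine ⟨c :: cs, by simp [h1], ?_⟩
    rw [decode, hc, h2]

/-- A connected finite set is covered by a closed walk. -/
lemma exists_cover {α : Type*} (R : α → α → Prop) (hR : ∀ a b, R a b → R b a) (B : Set α)
    (hB : B.Finite) (v : α) (hv : v ∈ B)
    (hconn : ∀ A ⊆ B, A.Nonempty → (∀ a ∈ A, ∀ b ∈ B, R a b → b ∈ A) → B ⊆ A) :
    ∃ l : List α, l.length = 2 * (B.ncard - 1) ∧ List.IsChain R (v :: l) ∧
      {a | a ∈ v :: l} = B := by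
  have main : ∀ k : ℕ, k + 1 ≤ B.ncard → ∃ l : List α, l.length = 2 * k ∧
      List.IsChain R (v :: l) ∧ {a | a ∈ v :: l} ⊆ B ∧ {a | a ∈ v :: l}.ncard = k + 1 := by
    intro k
    induction k with
    | zero =>
      intro _
      refine ⟨[], rfl, by simp, ?_, ?_⟩
      · intro a ha
        simp at ha
        rw [ha]; exact hv
      · simp
    | succ k ih =>
      intro hk
      obtain ⟨l, h1, h2, h3, h4⟩ := ih (by omega)
      have hnot : ¬ B ⊆ {a | a ∈ v :: l} := by
        intro hsub
        have := Set.ncard_le_ncard hsub (hB.subset h3)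
        omega
      have : ∃ a ∈ v :: l, ∃ b ∈ B, R a b ∧ b ∉ v :: l := by
        by_contra! hcon
        exact hnot (hconn _ h3 ⟨v, by simp⟩ (fun a ha b hb hab => hcon a ha b hb hab))
      obtain ⟨a, ha, b, hb, hab, hbl⟩ := this
      obtain ⟨l1, l2, hl⟩ := List.append_of_mem ha
      have hl' : ∃ l', v :: l' = l1 ++ a :: b :: a :: l2 := by
        rcases l1 with _ | ⟨w, l1⟩
        · simp only [List.nil_append, List.cons.injEq] at hl
          exact ⟨b :: a :: l2, by simp [hl.1]⟩
        · simp only [List.cons_append, List.cons.injEq] at hl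
          exact ⟨l1 ++ a :: b :: a :: l2, by simp [hl.1]⟩
      obtain ⟨l', hl'⟩ := hl'
      have hset : {c | c ∈ v :: l'} = insert b {c | c ∈ v :: l} := by
        ext c
        rw [hl', hl]
        simp only [Set.mem_setOf_eq, List.mem_append, List.mem_cons, Set.mem_insert_iff]
        tauto
      refine ⟨l', ?_, ?_, ?_, ?_⟩
      · have e1 := congrArg List.length hl'
        have e2 := congrArg List.length hl
        simp only [List.length_cons, List.length_append] at e1 e2
        omega
      · rw [hl']
        rw [hl, List.isChain_split] at h2
        rw [List.isChain_split]
        refine ⟨h2.1, ?_⟩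
        rw [List.isChain_cons_cons, List.isChain_cons_cons]
        exact ⟨hab, hR _ _ hab, h2.2⟩
      · rw [hset]
        exact Set.insert_subset hb h3
      · rw [hset, Set.ncard_insert_of_notMem (s := {c | c ∈ v :: l}) hbl (hB.subset h3), h4]
  have hpos : 0 < B.ncard := (Set.ncard_pos hB).2 ⟨v, hv⟩
  obtain ⟨l, h1, h2, h3, h4⟩ := main (B.ncard - 1) (by omega)
  exact ⟨l, h1, h2, Set.eq_of_subset_of_ncard_le h3 (by omega) hB⟩

lemma exists_start (hd : 2 ≤ d) (hd0 : 0 < d) (S : Finset (V d)) (h0 : (0 : V d) ∈ S) :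
    ∃ k : ℕ, k < (bd S).ncard ∧
      ((Pi.single (⟨0, hd0⟩ : Fin d) (k : ℤ) : V d), (⟨0, hd0⟩ : Fin d)) ∈ bd S := by
  set z : Fin d := ⟨0, hd0⟩ with hz
  set o : Fin d := ⟨1, by omega⟩ with ho
  have hzo : z ≠ o := by simp [hz, ho]
  obtain ⟨k, hk1, hk2⟩ := exists_exit S 0 h0 z
  simp only [zero_add] at hk1 hk2
  have hex : ∀ j : Fin (k + 1), ∃ t : ℕ,
      ((Pi.single z ((j : ℕ) : ℤ) + Pi.single o (t : ℤ) : V d), o) ∈ bd S := by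
    intro j
    obtain ⟨t, ht1, ht2⟩ := exists_exit S _ (hk1 j (by omega)) o
    refine ⟨t, fun hiff => ht2 ?_⟩
    have := hiff.1 (ht1 t le_rfl)
    simp only [add_assoc, ← Pi.single_add] at this
    exact this
  choose t ht using hex
  refine ⟨k, ?_, ?_⟩
  · haveI : Finite (bd S) := (bd_finite S).to_subtype
    have hinj : Function.Injective (fun j : Fin (k + 1) => (⟨_, ht j⟩ : bd S)) := by
      intro j j' h
      have h1 := congrFun (congrArg (fun e : bd S => e.1.1) h) z
      simp only [Pi.add_apply, Pi.single_eq_same, Pi.single_eq_of_ne hzo, add_zero] at h1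
      exact Fin.ext (by exact_mod_cast h1)
    have := Nat.card_le_card_of_injective _ hinj
    rw [Nat.card_coe_set_eq, Nat.card_fin] at this
    omega
  · intro hiff
    apply hk2
    have := hiff.1 (hk1 k le_rfl)
    simp only [← Pi.single_add] at this
    exact this

/-- the number of contours with `n` plaquettes surrounding the origin is at
most `(n+1) C_d^{2n+1}`. -/
theorem card_contours_around_origin (d : ℕ) (hd : 2 ≤ d) (n : ℕ) :
    Nat.card (GammaN0 d n) ≤ (n + 1) * (Cd d (by omega)) ^ (2 * n + 1) := by
  have hd0 : 0 < d := by omega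
  obtain ⟨nb, hnb⟩ := exists_nb hd hd0
  let z : Fin d := ⟨0, hd0⟩
  have hcode : ∀ γ : GammaN0 d n, ∃ (S : Finset (V d))
      (c : Fin n × List.Vector (Fin (Cd d hd0)) (2 * (n - 1))),
      γ.1 = frontier (cubes (↑S : Set (V d))) ∧
      bd S = {e | e ∈ decode nb ((Pi.single z ((c.1 : ℕ) : ℤ) : V d), z) c.2.toList} := by
    rintro ⟨γ, S, hS, rfl, hn, h0⟩
    rw [csize_eq] at hn
    obtain ⟨k, hk, hkb⟩ := exists_start hd hd0 S h0
    obtain ⟨l, h1, h2, h3⟩ := exists_cover nbr (fun _ _ => nbr_symm) (bd S) (bd_finite S) _ hkb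
      (by
        intro A hAB hne hA
        refine bd_connected z S hS A hAB ?_ hne
        intro e he e' he' hee
        by_cases heq : e' = e
        · rwa [heq]
        · exact hA e he e' he' ⟨heq, by rw [Set.inter_comm]; exact hee⟩)
    obtain ⟨cs, hcs1, hcs2⟩ := exists_decode nb nbr hnb l _ h2
    rw [hn] at h1 hk
    refine ⟨S, (⟨k, hk⟩, ⟨cs, hcs1.trans h1⟩), rfl, ?_⟩
    rw [← h3, ← hcs2]
    rfl
  choose S c hSγ hSc using hcode
  have hinj : Function.Injective c := by
    intro γ γ' h
    apply Subtype.ext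
    rw [hSγ, hSγ]
    have : bd (S γ) = bd (S γ') := by rw [hSc, hSc, h]
    rw [bd_injective z this]
  have hle := Nat.card_le_card_of_injective c hinj
  rw [Nat.card_prod, Nat.card_fin, Nat.card_eq_fintype_card (α := List.Vector _ _), card_vector, Fintype.card_fin] at hle
  exact hle.trans (Nat.mul_le_mul (by omega)
    (Nat.pow_le_pow_right (Cd_pos hd hd0) (by omega)))

end
end Ising
end

section
/- Let d ≥ 2, let Ψ be a translation invariant interaction on Ω = {1,-1}^{Z^d} with |||Ψ|||' < ∞, and let Ψ̃ be its rectangle regrouping. Then for every interaction Φ_0, the interactions Φ = Φ_0 + Ψ and Φ̃ = Φ_0 + Ψ̃ have the same Gibbs states: K_Φ = K_{Φ̃}. -/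
open scoped BigOperators
open Real MeasureTheory Filter Topology

namespace Ising

variable {d : ℕ}

noncomputable section

/-! ### Helper lemmas -/

lemma supNorm_bdd (Φ : Interaction d) (h : IsLocal Φ) (Λ : Finset (V d)) :
    BddAbove (Set.range fun ω : Config d => |Φ Λ ω|) := by
  have hfin : (Set.range fun ω : Config d => |Φ Λ ω|).Finite := by
    refine (Set.finite_range fun f : ↥Λ → Bool => |Φ Λ (fill Λ f plusC)|).subset ?_
    rintro _ ⟨ω, rfl⟩
    refine ⟨fun x => ω x, ?_⟩
    simp only
    rw [h Λ (fill Λ (fun x => ω x) plusC) ω]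
    intro x hx
    simp [fill, hx]
  exact hfin.bddAbove

lemma abs_le_supNorm (Φ : Interaction d) (h : IsLocal Φ) (Λ : Finset (V d)) (ω : Config d) :
    |Φ Λ ω| ≤ supNorm Φ Λ :=
  le_ciSup (supNorm_bdd Φ h Λ) ω

lemma supNorm_nonneg (Φ : Interaction d) (Λ : Finset (V d)) : 0 ≤ supNorm Φ Λ :=
  Real.iSup_nonneg fun _ => abs_nonneg _

/-- Translation of finite sets. -/
def shiftE (a : V d) : Finset (V d) ≃ Finset (V d) := (Equiv.subRight a).finsetCongr

lemma shiftE_eq (a : V d) (Λ : Finset (V d)) : shiftE a Λ = Λ.image (fun x => x - a) := by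
  ext y
  simp only [shiftE, Equiv.finsetCongr_apply, Finset.mem_map, Finset.mem_image]
  rfl

lemma mem_shiftE (a : V d) (Λ : Finset (V d)) (y : V d) : y ∈ shiftE a Λ ↔ y + a ∈ Λ := by
  rw [shiftE_eq]
  simp only [Finset.mem_image]
  constructor
  · rintro ⟨x, hx, rfl⟩
    simpa using hx
  · intro h
    exact ⟨_, h, by simp⟩

lemma card_shiftE (a : V d) (Λ : Finset (V d)) : (shiftE a Λ).card = Λ.card := by
  simp [shiftE, Equiv.finsetCongr_apply]

lemma supNorm_shiftE (Φ : Interaction d) (h : TransInv Φ) (a : V d) (Λ : Finset (V d)) :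
    supNorm Φ (shiftE a Λ) = supNorm Φ Λ := by
  unfold supNorm
  have hs : Function.Surjective (translate a : Config d → Config d) := by
    intro ω
    refine ⟨fun x => ω (x - a), ?_⟩
    funext x
    simp [translate]
  rw [← hs.iSup_comp]
  refine iSup_congr fun ω => ?_
  rw [shiftE_eq, h a Λ ω]

lemma mem_minRect (Λ : Finset (V d)) (y : V d) :
    y ∈ minRect Λ ↔ Λ.Nonempty ∧ ∀ i, (∃ u ∈ Λ, u i ≤ y i) ∧ (∃ v ∈ Λ, y i ≤ v i) := by
  unfold minRect
  split_ifs with h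
  · simp only [Finset.mem_Icc, Pi.le_def, Finset.inf'_le_iff, Finset.le_sup'_iff, h, true_and,
      forall_and]
  · simp [h]

lemma subset_minRect (Λ : Finset (V d)) : Λ ⊆ minRect Λ := by
  intro x hx
  rw [mem_minRect]
  exact ⟨⟨x, hx⟩, fun i => ⟨⟨x, hx, le_rfl⟩, ⟨x, hx, le_rfl⟩⟩⟩

lemma mem_minRect_shiftE (a : V d) (Λ : Finset (V d)) (y : V d) :
    y ∈ minRect (shiftE a Λ) ↔ y + a ∈ minRect Λ := by
  rw [mem_minRect, mem_minRect, ← Finset.card_pos, card_shiftE, Finset.card_pos, shiftE_eq]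
  simp only [Finset.exists_mem_image, Pi.sub_apply, Pi.add_apply, sub_le_iff_le_add,
    le_sub_iff_add_le]

lemma isRect_minRect (Λ : Finset (V d)) (h : Λ.Nonempty) : IsRect (minRect Λ) := by
  obtain ⟨x, hx⟩ := h
  unfold minRect
  rw [dif_pos ⟨x, hx⟩]
  refine ⟨_, _, ?_, rfl⟩
  intro i
  exact (Finset.inf'_le (fun x : V d => x i) hx).trans (Finset.le_sup' (fun x : V d => x i) hx)

lemma card_minRect_le (Λ : Finset (V d)) : (minRect Λ).card ≤ (diam Λ + 1) ^ d := by
  unfold minRect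
  split_ifs with h
  · rw [Pi.card_Icc]
    have : ∀ i ∈ (Finset.univ : Finset (Fin d)),
        (Finset.Icc (Λ.inf' h fun x => x i) (Λ.sup' h fun x => x i)).card ≤ diam Λ + 1 := by
      intro i _
      obtain ⟨u, hu, hu'⟩ := Finset.exists_mem_eq_inf' h (fun x : V d => x i)
      obtain ⟨v, hv, hv'⟩ := Finset.exists_mem_eq_sup' h (fun x : V d => x i)
      rw [hu', hv', Int.card_Icc]
      have h1 : (v i - u i).natAbs ≤ distInf v u :=
        Finset.le_sup (f := fun i => (v i - u i).natAbs) (Finset.mem_univ i)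
      have h2 : distInf v u ≤ Λ.sup fun y => distInf v y :=
        Finset.le_sup (f := fun y => distInf v y) hu
      have h3 : (Λ.sup fun y => distInf v y) ≤ diam Λ :=
        Finset.le_sup (f := fun x => Λ.sup fun y => distInf x y) hv
      omega
    calc _ ≤ _ := Finset.prod_le_pow_card _ _ _ this
      _ = _ := by simp
  · simp

open scoped Classical ENNReal in
lemma summable_minRect (Ψ : Interaction d) (hti : TransInv Ψ) (hsum : DSummable' Ψ) (y : V d) :
    Summable fun Δ : Finset (V d) => if y ∈ minRect Δ then supNorm Ψ Δ else 0 := by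
  have hn : ∀ Δ : Finset (V d), 0 ≤ if y ∈ minRect Δ then supNorm Ψ Δ else 0 := by
    intro Δ
    split_ifs
    · exact supNorm_nonneg _ _
    · exact le_rfl
  have hfin : ∑' Δ : Finset (V d), ENNReal.ofReal (dTerm' Ψ Δ) ≠ ∞ :=
    hsum.tsum_ofReal_ne_top
  let F : Finset (V d) → ℝ≥0∞ := fun Δ => (Δ.card : ℝ≥0∞)⁻¹ * ENNReal.ofReal (supNorm Ψ Δ)
  have hF : ∀ a Δ, F (shiftE a Δ) = F Δ := by
    intro a Δ
    simp only [F, card_shiftE, supNorm_shiftE Ψ hti]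
  have key : ∑' Δ : Finset (V d), ENNReal.ofReal (if y ∈ minRect Δ then supNorm Ψ Δ else 0)
      ≤ ∑' Δ : Finset (V d), ENNReal.ofReal (dTerm' Ψ Δ) := by
    calc ∑' Δ : Finset (V d), ENNReal.ofReal (if y ∈ minRect Δ then supNorm Ψ Δ else 0)
        = ∑' Δ : Finset (V d), ∑' x : V d, (if x ∈ Δ ∧ y ∈ minRect Δ then F Δ else 0) := by
          refine tsum_congr fun Δ => ?_
          by_cases hy : y ∈ minRect Δ
          · have hne : Δ.Nonempty := ((mem_minRect _ _).1 hy).1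
            rw [tsum_eq_sum (s := Δ) (by intro x hx; simp [hx])]
            rw [Finset.sum_congr rfl (g := fun _ => F Δ) (by intro x hx; simp [hx, hy])]
            simp only [Finset.sum_const, nsmul_eq_mul, F, hy, if_true]
            rw [← mul_assoc, ENNReal.mul_inv_cancel, one_mul]
            · simpa using hne.ne_empty
            · simp
          · simp [hy]
      _ = ∑' x : V d, ∑' Δ : Finset (V d), (if x ∈ Δ ∧ y ∈ minRect Δ then F Δ else 0) :=
          ENNReal.tsum_comm
      _ = ∑' x : V d, ∑' Δ : Finset (V d),
            (if (0 : V d) ∈ Δ ∧ y - x ∈ minRect Δ then F Δ else 0) := by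
          refine tsum_congr fun x => ?_
          symm
          rw [← (shiftE x).tsum_eq]
          refine tsum_congr fun Δ => ?_
          simp only [mem_shiftE, mem_minRect_shiftE, hF, zero_add, sub_add_cancel]
      _ = ∑' Δ : Finset (V d), ∑' x : V d,
            (if (0 : V d) ∈ Δ ∧ y - x ∈ minRect Δ then F Δ else 0) := ENNReal.tsum_comm
      _ ≤ ∑' Δ : Finset (V d), ENNReal.ofReal (dTerm' Ψ Δ) := by
          refine ENNReal.tsum_le_tsum fun Δ => ?_
          by_cases h0 : (0 : V d) ∈ Δ
          · have e : ∑' x : V d, (if (0 : V d) ∈ Δ ∧ y - x ∈ minRect Δ then F Δ else 0)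
                = ((minRect Δ).card : ℝ≥0∞) * F Δ := by
              rw [← (Equiv.subLeft y).tsum_eq]
              rw [tsum_eq_sum (s := minRect Δ) (by intro x hx; simp [hx])]
              rw [Finset.sum_congr rfl (g := fun _ => F Δ) (by intro x hx; simp [hx, h0])]
              simp
            rw [e]
            have hc : (0 : ℝ) < Δ.card := by
              exact_mod_cast Finset.card_pos.2 ⟨_, h0⟩
            simp only [dTerm', h0, if_true, F]
            rw [ENNReal.ofReal_mul (by positivity), ENNReal.ofReal_mul (by positivity),
              ENNReal.ofReal_inv_of_pos hc, ENNReal.ofReal_natCast, ← mul_assoc,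
              mul_comm ((minRect Δ).card : ℝ≥0∞)]
            gcongr
            rw [← Nat.cast_pow, ENNReal.ofReal_natCast]
            exact_mod_cast card_minRect_le Δ
          · simp [h0]
  have := ENNReal.summable_toReal (ne_top_of_le_ne_top hfin key)
  refine this.congr fun Δ => ?_
  rw [ENNReal.toReal_ofReal (hn Δ)]

lemma summable_mem (Φ : Interaction d) (hti : TransInv Φ) (hsum : AbsSummable Φ) (y : V d) :
    Summable fun Δ : Finset (V d) => if y ∈ Δ then supNorm Φ Δ else 0 := by
  have h := (shiftE y).summable_iff.2 hsum
  refine h.congr fun Δ => ?_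
  simp only [Function.comp, normTerm, mem_shiftE, zero_add, supNorm_shiftE Φ hti]

/-- A general summability statement for sums over sets whose hull meets `Λ`. -/
lemma summable_meet (s : Finset (V d) → ℝ) (hs : ∀ Δ, 0 ≤ s Δ)
    (g : Finset (V d) → Finset (V d))
    (h : ∀ y, Summable fun Δ : Finset (V d) => if y ∈ g Δ then s Δ else 0)
    (Λ : Finset (V d)) :
    Summable fun Δ : Finset (V d) => if (g Δ ∩ Λ).Nonempty then s Δ else 0 := by
  have hS : Summable fun Δ : Finset (V d) => ∑ y ∈ Λ, if y ∈ g Δ then s Δ else 0 :=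
    summable_sum fun y _ => h y
  refine Summable.of_nonneg_of_le (fun Δ => ?_) (fun Δ => ?_) hS
  · split_ifs
    · exact hs Δ
    · exact le_rfl
  · have hnn : ∀ y ∈ Λ, (0 : ℝ) ≤ if y ∈ g Δ then s Δ else 0 := by
      intro y _
      split_ifs
      · exact hs Δ
      · exact le_rfl
    split_ifs with hne
    · obtain ⟨y, hy⟩ := hne
      rw [Finset.mem_inter] at hy
      calc s Δ = if y ∈ g Δ then s Δ else 0 := by simp [hy.1]
        _ ≤ _ := Finset.single_le_sum hnn hy.2
    · exact Finset.sum_nonneg hnn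

lemma regroup_hasSum (Ψ : Interaction d) (Λ : Finset (V d)) (ω : Config d)
    (h : Summable fun Δ : Finset (V d) => if (minRect Δ ∩ Λ).Nonempty then Ψ Δ ω else 0) :
    HasSum (fun R : Finset (V d) => if (R ∩ Λ).Nonempty then regroup Ψ R ω else 0)
      (∑' Δ : Finset (V d), if (minRect Δ ∩ Λ).Nonempty then Ψ Δ ω else 0) := by
  classical
  have hh := h.hasSum.tsum_fiberwise (minRect : Finset (V d) → Finset (V d))
  refine (congrArg (fun F => HasSum F (∑' Δ : Finset (V d),
    if (minRect Δ ∩ Λ).Nonempty then Ψ Δ ω else 0)) (funext fun R => ?_)).mpr hh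
  rw [tsum_subtype (minRect ⁻¹' {R})
    (fun Δ : Finset (V d) => if (minRect Δ ∩ Λ).Nonempty then Ψ Δ ω else 0)]
  by_cases hR : (R ∩ Λ).Nonempty
  · rw [if_pos hR, tsum_eq_sum (s := R.powerset)]
    · unfold regroup
      split_ifs with hr
      · refine Finset.sum_congr rfl fun Δ _ => ?_
        by_cases e : minRect Δ = R
        · simp [Set.indicator, e, hR]
        · simp [Set.indicator, e]
      · symm
        refine Finset.sum_eq_zero fun Δ _ => ?_
        rw [Set.indicator_of_notMem]
        intro e
        simp only [Set.mem_preimage, Set.mem_singleton_iff] at e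
        apply hr
        rw [← e]
        refine isRect_minRect Δ ?_
        obtain ⟨y, hy⟩ := hR
        rw [← e, Finset.mem_inter, mem_minRect] at hy
        exact hy.1.1
    · intro Δ hΔ
      rw [Set.indicator_of_notMem]
      intro e
      simp only [Set.mem_preimage, Set.mem_singleton_iff] at e
      apply hΔ
      rw [Finset.mem_powerset, ← e]
      exact subset_minRect Δ
  · rw [if_neg hR]
    symm
    convert tsum_zero with Δ
    by_cases e : minRect Δ = R
    · simp [Set.indicator, e, hR]
    · simp [Set.indicator, e]

/-- The difference of the two Hamiltonians. -/
def hamDiff (Ψ : Interaction d) (Λ : Finset (V d)) (ω : Config d) : ℝ :=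
  ∑' Δ : Finset (V d), if (minRect Δ ∩ Λ).Nonempty ∧ ¬ (Δ ∩ Λ).Nonempty then Ψ Δ ω else 0

lemma hamDiff_fill (Ψ : Interaction d) (hloc : IsLocal Ψ) (Λ : Finset (V d))
    (f : ↥Λ → Bool) (η : Config d) : hamDiff Ψ Λ (fill Λ f η) = hamDiff Ψ Λ η := by
  refine tsum_congr fun Δ => ?_
  split_ifs with h
  · refine hloc Δ _ _ fun x hx => ?_
    have : x ∉ Λ := fun hx' => h.2 ⟨x, Finset.mem_inter.2 ⟨hx, hx'⟩⟩
    simp [fill, this]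
  · rfl

lemma summable_of_bound (Ψ : Interaction d) (hloc : IsLocal Ψ) (P : Finset (V d) → Prop)
    [DecidablePred P]
    (h : Summable fun Δ : Finset (V d) => if P Δ then supNorm Ψ Δ else 0) (ω : Config d) :
    Summable fun Δ : Finset (V d) => if P Δ then Ψ Δ ω else 0 := by
  refine Summable.of_norm_bounded h fun Δ => ?_
  split_ifs
  · exact abs_le_supNorm Ψ hloc Δ ω
  · simp

lemma ham_regroup (Ψ : Interaction d) (hloc : IsLocal Ψ) (hti : TransInv Ψ)
    (hsum : DSummable' Ψ) (Φ₀ : Interaction d) (hloc0 : IsLocal Φ₀) (hti0 : TransInv Φ₀)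
    (hsum0 : AbsSummable Φ₀) (Λ : Finset (V d)) (ω : Config d) :
    ham (Iadd Φ₀ (regroup Ψ)) Λ ω = ham (Iadd Φ₀ Ψ) Λ ω + hamDiff Ψ Λ ω := by
  have s0 : Summable fun Δ : Finset (V d) => if (Δ ∩ Λ).Nonempty then Φ₀ Δ ω else 0 :=
    summable_of_bound Φ₀ hloc0 (fun Δ => (Δ ∩ Λ).Nonempty)
      (summable_meet (supNorm Φ₀) (supNorm_nonneg Φ₀) id (summable_mem Φ₀ hti0 hsum0) Λ) ω
  have s1 : Summable fun Δ : Finset (V d) =>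
      if (minRect Δ ∩ Λ).Nonempty then Ψ Δ ω else 0 :=
    summable_of_bound Ψ hloc (fun Δ => (minRect Δ ∩ Λ).Nonempty)
      (summable_meet (supNorm Ψ) (supNorm_nonneg Ψ) minRect
        (fun y => (summable_minRect Ψ hti hsum y).congr fun Δ => by congr) Λ) ω
  have hmono : ∀ Δ : Finset (V d), (Δ ∩ Λ).Nonempty → (minRect Δ ∩ Λ).Nonempty :=
    fun Δ h => h.mono (Finset.inter_subset_inter_right (subset_minRect Δ))
  have s2 : Summable fun Δ : Finset (V d) => if (Δ ∩ Λ).Nonempty then Ψ Δ ω else 0 := by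
    refine Summable.of_norm_bounded s1.norm fun Δ => ?_
    by_cases h : (Δ ∩ Λ).Nonempty
    · simp [h, hmono Δ h]
    · simp [h]
  have s3 : Summable fun Δ : Finset (V d) =>
      if (minRect Δ ∩ Λ).Nonempty ∧ ¬ (Δ ∩ Λ).Nonempty then Ψ Δ ω else 0 := by
    refine (s1.sub s2).congr fun Δ => ?_
    by_cases h : (Δ ∩ Λ).Nonempty
    · simp [h, hmono Δ h]
    · simp [h]
  have s4 := regroup_hasSum Ψ Λ ω s1
  have e1 : ham (Iadd Φ₀ (regroup Ψ)) Λ ω = ham Φ₀ Λ ω +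
      ∑' Δ : Finset (V d), if (minRect Δ ∩ Λ).Nonempty then Ψ Δ ω else 0 := by
    rw [← s4.tsum_eq]
    unfold ham
    rw [← s0.tsum_add s4.summable]
    refine tsum_congr fun Δ => ?_
    split_ifs <;> simp [Iadd]
  have e2 : ham (Iadd Φ₀ Ψ) Λ ω = ham Φ₀ Λ ω + ham Ψ Λ ω := by
    unfold ham
    rw [← s0.tsum_add s2]
    refine tsum_congr fun Δ => ?_
    split_ifs <;> simp [Iadd]
  rw [e1, e2, add_assoc]
  congr 1
  unfold ham hamDiff
  rw [← s2.tsum_add s3]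
  refine tsum_congr fun Δ => ?_
  by_cases h : (Δ ∩ Λ).Nonempty
  · simp [h, hmono Δ h]
  · simp [h]

/-- the rectangle regrouping `Ψ̃` of `Ψ` induces the same Gibbs states:
`K_{Φ₀+Ψ} = K_{Φ₀+Ψ̃}`. -/
theorem regroup_same_gibbs (d : ℕ) (hd : 2 ≤ d)
    (Ψ : Interaction d) (hloc : IsLocal Ψ) (hti : TransInv Ψ) (hsum : DSummable' Ψ)
    (Φ₀ : Interaction d) (hloc0 : IsLocal Φ₀) (hti0 : TransInv Φ₀)
    (hsum0 : AbsSummable Φ₀) :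
    ∀ σ : Measure (Config d),
      IsGibbs (Iadd Φ₀ Ψ) σ ↔ IsGibbs (Iadd Φ₀ (regroup Ψ)) σ := by
  intro σ
  have h : ∀ (Λ : Finset (V d)) (η : Config d) (f : ↥Λ → Bool),
      finGibbs (Iadd Φ₀ (regroup Ψ)) Λ η f = finGibbs (Iadd Φ₀ Ψ) Λ η f := by
    intro Λ η f
    have hz : ∀ g : ↥Λ → Bool, Real.exp (-(ham (Iadd Φ₀ (regroup Ψ)) Λ (fill Λ g η))) =
        Real.exp (-(ham (Iadd Φ₀ Ψ) Λ (fill Λ g η))) * Real.exp (-(hamDiff Ψ Λ η)) := by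
      intro g
      rw [ham_regroup Ψ hloc hti hsum Φ₀ hloc0 hti0 hsum0, hamDiff_fill Ψ hloc, neg_add,
        Real.exp_add]
    unfold finGibbs gibbsZ
    simp only [hz]
    rw [← Finset.sum_mul, mul_div_mul_right _ _ (Real.exp_ne_zero _)]
  unfold IsGibbs
  simp only [h]

end
end Ising
end
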